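/- arXiv:1102.1510 — 2 statements merged into one kernel-verified Lean document; each statement's English description precedes it below -/
import Mathlib

section
/- Let D be a nonempty closed convex bounded subset of a strictly convex Banach space X, let t : D → D be a single-valued mapping satisfying conditions (E) and (C_λ) for some λ ∈ (0,1), and let T : D → KC(D) be a multivalued mapping with compact convex values such that t and T commute. Then for every x ∈ Fix(t), the set Tx is invariant under t and Tx ∩ Fix(t) ≠ ∅, provided the asymptotic center relative to any nonempty compact convex subset of each sequence therein is nonempty and compact (which holds automatically since such sets are compact). -/
open Filter Topology

section GoebelKirk

variable {X : Type*} [NormedAddCommGroup X] [NormedSpace ℝ X] {l : ℝ} {x y : ℕ → X}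

/-- Along a Krasnoselskii-Mann averaging scheme the displacement is nonincreasing. -/
theorem antitone_displacement (hl : l ∈ Set.Ioo (0 : ℝ) 1)
    (hx : ∀ n, x (n + 1) = (1 - l) • x n + l • y n)
    (hy : ∀ n, ‖y (n + 1) - y n‖ ≤ l * ‖y n - x n‖) :
    Antitone fun n => ‖y n - x n‖ := by
  refine antitone_nat_of_succ_le fun n => ?_
  have h : y (n + 1) - x (n + 1) = (y (n + 1) - y n) + (1 - l) • (y n - x n) := by
    rw [hx]; module
  calc ‖y (n + 1) - x (n + 1)‖ ≤ ‖y (n + 1) - y n‖ + ‖(1 - l) • (y n - x n)‖ := by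
        rw [h]; exact norm_add_le _ _
    _ = ‖y (n + 1) - y n‖ + (1 - l) * ‖y n - x n‖ := by
        rw [norm_smul, Real.norm_of_nonneg (by linarith [hl.2])]
    _ ≤ ‖y n - x n‖ := by linarith [hy n]

/-- The total drift of `y` over `n` steps is at most `n` times its first bound. -/
theorem norm_sub_le_drift (hl : l ∈ Set.Ioo (0 : ℝ) 1)
    (hx : ∀ n, x (n + 1) = (1 - l) • x n + l • y n)
    (hy : ∀ n, ‖y (n + 1) - y n‖ ≤ l * ‖y n - x n‖) (i n : ℕ) :
    ‖y (i + n) - y i‖ ≤ n * (l * ‖y i - x i‖) := by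
  induction n with
  | zero => simp
  | succ n ih =>
    have h₁ : ‖y (i + n) - x (i + n)‖ ≤ ‖y i - x i‖ :=
      antitone_displacement hl hx hy (Nat.le_add_right i n)
    have h₂ := mul_le_mul_of_nonneg_left h₁ hl.1.le
    have h₃ := norm_sub_le_norm_sub_add_norm_sub (y (i + n + 1)) (y (i + n)) (y i)
    push_cast
    rw [← add_assoc]
    linarith [hy (i + n)]

/-- The Goebel-Kirk inequality. -/
theorem goebel_kirk_inequality (hl : l ∈ Set.Ioo (0 : ℝ) 1)
    (hx : ∀ n, x (n + 1) = (1 - l) • x n + l • y n)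
    (hy : ∀ n, ‖y (n + 1) - y n‖ ≤ l * ‖y n - x n‖) (n i : ℕ) :
    (1 + n * l) * ‖y i - x i‖ ≤
      ‖y (i + n) - x i‖ + (1 - l)⁻¹ ^ n * (‖y i - x i‖ - ‖y (i + n) - x (i + n)‖) := by
  have hl0 : 0 < l := hl.1
  have hl1 : 0 < 1 - l := by linarith [hl.2]
  induction n generalizing i with
  | zero => simp
  | succ n ih =>
    have hanti : ‖y (i + 1) - x (i + 1)‖ ≤ ‖y i - x i‖ :=
      antitone_displacement hl hx hy (Nat.le_succ i)
    have hdrift := norm_sub_le_drift hl hx hy i (n + 1)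
    have hbern : 1 + n * l ≤ (1 - l)⁻¹ ^ n := by
      have h₁ : 1 + l ≤ (1 - l)⁻¹ := by
        rw [le_inv_comm₀ (by linarith) hl1, ← one_div, le_div_iff₀ (by linarith)]
        nlinarith
      exact (one_add_mul_le_pow (by linarith) n).trans
        (pow_le_pow_left₀ (by linarith) h₁ n)
    have hsplit : ‖y (i + (n + 1)) - x (i + 1)‖ ≤
        (1 - l) * ‖y (i + (n + 1)) - x i‖ + l * ‖y (i + (n + 1)) - y i‖ := by
      have h : y (i + (n + 1)) - x (i + 1) =
          (1 - l) • (y (i + (n + 1)) - x i) + l • (y (i + (n + 1)) - y i) := by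
        rw [hx]; module
      rw [h]
      refine (norm_add_le _ _).trans_eq ?_
      rw [norm_smul, norm_smul, Real.norm_of_nonneg hl1.le, Real.norm_of_nonneg hl0.le]
    have hih := ih (i + 1)
    rw [add_right_comm i 1 n, add_assoc i n 1] at hih
    have hprod := mul_le_mul_of_nonneg_right hbern (sub_nonneg.2 hanti)
    have hdrift' := mul_le_mul_of_nonneg_left hdrift hl0.le
    have hpow : (1 - l) * (1 - l)⁻¹ ^ (n + 1) = (1 - l)⁻¹ ^ n := by
      rw [pow_succ', mul_inv_cancel_left₀ hl1.ne']
    refine le_of_mul_le_mul_left ?_ hl1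
    rw [mul_add, ← mul_assoc (1 - l) (_ ^ _), hpow]
    push_cast at hdrift' ⊢
    linarith

/-- Goebel-Kirk: the displacement along a bounded averaging scheme tends to zero. -/
theorem tendsto_displacement_zero (hl : l ∈ Set.Ioo (0 : ℝ) 1)
    (hx : ∀ n, x (n + 1) = (1 - l) • x n + l • y n)
    (hy : ∀ n, ‖y (n + 1) - y n‖ ≤ l * ‖y n - x n‖)
    {B : ℝ} (hB : ∀ m n, ‖y m - x n‖ ≤ B) :
    Tendsto (fun n => ‖y n - x n‖) atTop (𝓝 0) := by
  have hbdd : BddBelow (Set.range fun n => ‖y n - x n‖) :=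
    ⟨0, by rintro _ ⟨n, rfl⟩; exact norm_nonneg _⟩
  have hlim := tendsto_atTop_ciInf (antitone_displacement hl hx hy) hbdd
  set d := ⨅ n, ‖y n - x n‖
  have hd0 : 0 ≤ d := Real.iInf_nonneg fun n => norm_nonneg _
  have hd (n : ℕ) : (1 + n * l) * d ≤ B := by
    have hshift := hlim.comp (tendsto_add_atTop_nat n)
    have h := ((hlim.sub hshift).const_mul ((1 - l)⁻¹ ^ n)).const_add B
    rw [sub_self, mul_zero, add_zero] at h
    refine le_of_tendsto_of_tendsto' (hlim.const_mul (1 + n * l)) h fun i => ?_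
    exact (goebel_kirk_inequality hl hx hy n i).trans (add_le_add_left (hB _ _) _)
  have hd_eq : d = 0 := by
    by_contra hne
    have hpos : 0 < l * d := mul_pos hl.1 (lt_of_le_of_ne hd0 (Ne.symm hne))
    obtain ⟨n, hn⟩ := exists_nat_gt (B / (l * d))
    rw [div_lt_iff₀ hpos] at hn
    linarith [hd n]
  rwa [hd_eq] at hlim

end GoebelKirk

/-- A self-map of a nonempty compact convex set satisfying conditions `(C_λ)` and `(E)` has a
fixed point. -/
theorem exists_fixedPoint_of_isCompact_of_convex {X : Type*} [NormedAddCommGroup X]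
    [NormedSpace ℝ X] {K : Set X} (hne : K.Nonempty) (hK : IsCompact K) (hconv : Convex ℝ K)
    {t : X → X} (ht : Set.MapsTo t K K) {l : ℝ} (hl : l ∈ Set.Ioo (0 : ℝ) 1)
    (htC : ∀ x ∈ K, ∀ y ∈ K, l * ‖x - t x‖ ≤ ‖x - y‖ → ‖t x - t y‖ ≤ ‖x - y‖)
    {μ : ℝ} (htE : ∀ x ∈ K, ∀ y ∈ K, ‖x - t y‖ ≤ μ * ‖x - t x‖ + ‖x - y‖) :
    ∃ z ∈ K, t z = z := by
  obtain ⟨x₀, hx₀⟩ := hne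
  let f : X → X := fun z => (1 - l) • z + l • t z
  let x : ℕ → X := fun n => f^[n] x₀
  have hx (n : ℕ) : x (n + 1) = (1 - l) • x n + l • t (x n) :=
    Function.iterate_succ_apply' f n x₀
  have hxK (n : ℕ) : x n ∈ K := by
    induction n with
    | zero => exact hx₀
    | succ n ih =>
      rw [hx]
      exact hconv ih (ht ih) (by linarith [hl.2]) hl.1.le (by ring)
  have hstep (n : ℕ) : ‖x n - x (n + 1)‖ = l * ‖x n - t (x n)‖ := by
    have h : x n - x (n + 1) = l • (x n - t (x n)) := by rw [hx]; module
    rw [h, norm_smul, Real.norm_of_nonneg hl.1.le]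
  have hy (n : ℕ) : ‖t (x (n + 1)) - t (x n)‖ ≤ l * ‖t (x n) - x n‖ := by
    rw [norm_sub_rev, norm_sub_rev (t (x n)) (x n), ← hstep]
    exact htC _ (hxK n) _ (hxK (n + 1)) (hstep n).ge
  have hlim : Tendsto (fun n => ‖t (x n) - x n‖) atTop (𝓝 0) :=
    tendsto_displacement_zero hl hx hy (B := Metric.diam K) fun m n => by
      rw [← dist_eq_norm]
      exact Metric.dist_le_diam_of_mem hK.isBounded (ht (hxK m)) (hxK n)
  obtain ⟨z, hz, φ, hφ, hφz⟩ := hK.tendsto_subseq hxK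
  refine ⟨z, hz, tendsto_nhds_unique ?_ hφz⟩
  have hbound : Tendsto (fun n => μ * ‖t (x (φ n)) - x (φ n)‖ + ‖x (φ n) - z‖) atTop (𝓝 0) := by
    have h := ((hlim.comp hφ.tendsto_atTop).const_mul μ).add
      (tendsto_iff_norm_sub_tendsto_zero.1 hφz)
    rwa [mul_zero, add_zero] at h
  refine tendsto_iff_norm_sub_tendsto_zero.2
    (squeeze_zero (fun _ => norm_nonneg _) (fun n => ?_) hbound)
  rw [norm_sub_rev (t (x (φ n)))]
  exact htE _ (hxK _) _ hz


/-- Let `D` be a nonempty closed convex bounded subset of a strictly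
convex Banach space, `t : D → D` satisfy conditions (E) and `(C_λ)` for some
`λ ∈ (0,1)`, and `T : D → KC(D)` be a multivalued mapping with nonempty compact convex
values such that `t` and `T` commute. Then for every `x ∈ Fix(t)`, the set `Tx` is
invariant under `t` and `Tx ∩ Fix(t) ≠ ∅`. -/
theorem Tx_invariant_and_meets_fix {X : Type*} [NormedAddCommGroup X] [NormedSpace ℝ X]
    [CompleteSpace X] [StrictConvexSpace ℝ X]
    (D : Set X) (hne : D.Nonempty) (hcl : IsClosed D) (hconv : Convex ℝ D)
    (hbdd : Bornology.IsBounded D)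
    (t : X → X) (ht : Set.MapsTo t D D)
    (l : ℝ) (hl : l ∈ Set.Ioo (0:ℝ) 1)
    (htC : ∀ x ∈ D, ∀ y ∈ D, l * ‖x - t x‖ ≤ ‖x - y‖ → ‖t x - t y‖ ≤ ‖x - y‖)
    (htE : ∃ μ : ℝ, 1 ≤ μ ∧ ∀ x ∈ D, ∀ y ∈ D, ‖x - t y‖ ≤ μ * ‖x - t x‖ + ‖x - y‖)
    (T : X → Set X)
    (hTne : ∀ x ∈ D, (T x).Nonempty) (hTcp : ∀ x ∈ D, IsCompact (T x))
    (hTconv : ∀ x ∈ D, Convex ℝ (T x)) (hTsub : ∀ x ∈ D, T x ⊆ D)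
    (hcomm : ∀ x ∈ D, ∀ y ∈ D, x ∈ T y → t y ∈ D → t x ∈ T (t y)) :
    ∀ x ∈ D, t x = x →
      Set.MapsTo t (T x) (T x) ∧ (T x ∩ {z ∈ D | t z = z}).Nonempty := by
  intro x hx hfix
  have hmaps : Set.MapsTo t (T x) (T x) := fun z hz => by
    have h := hcomm z (hTsub x hx hz) x hx hz (ht hx)
    rwa [hfix] at h
  obtain ⟨μ, -, hμ⟩ := htE
  obtain ⟨z, hz, hfz⟩ := exists_fixedPoint_of_isCompact_of_convex (hTne x hx) (hTcp x hx)
    (hTconv x hx) hmaps hl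
    (fun a ha b hb => htC a (hTsub x hx ha) b (hTsub x hx hb))
    (fun a ha b hb => hμ a (hTsub x hx ha) b (hTsub x hx hb))
  exact ⟨hmaps, z, hz, hTsub x hx hz, hfz⟩
end

section
/- Let D be a nonempty compact convex subset of a strictly convex Banach space X, let t : D → D be a nonexpansive single-valued mapping and T : D → KC(D) a nonexpansive multivalued mapping, and suppose t and T commute. Then there exists a point z ∈ D such that z = t(z) ∈ T(z). -/
open Filter Topology in
/-- A multivalued nonexpansive mapping with closed values on a nonempty compact convex set has a
fixed point. -/
theorem exists_mem_self_of_nonexpansive_setValued {X : Type*}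
    [NormedAddCommGroup X] [NormedSpace ℝ X] {K : Set X} (hne : K.Nonempty) (hcp : IsCompact K)
    (hconv : Convex ℝ K) (S : X → Set X) (hSne : ∀ x ∈ K, (S x).Nonempty)
    (hScl : ∀ x ∈ K, IsClosed (S x)) (hSsub : ∀ x ∈ K, S x ⊆ K)
    (hS : ∀ x ∈ K, ∀ y ∈ K, ∀ p ∈ S x, ∃ q ∈ S y, ‖p - q‖ ≤ ‖x - y‖) :
    ∃ z ∈ K, z ∈ S z := by
  obtain ⟨p₀, hp₀⟩ := hne
  set G : Set (X × X) := {w | w.1 ∈ K ∧ w.2 ∈ S w.1} with hG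
  have hGsub : G ⊆ K ×ˢ K := fun w hw => ⟨hw.1, hSsub _ hw.1 hw.2⟩
  have hGcl : IsClosed G := by
    refine isSeqClosed_iff_isClosed.mp fun w a hw ha => ?_
    have h1 : Tendsto (fun n => (w n).1) atTop (𝓝 a.1) := (continuous_fst.tendsto a).comp ha
    have h2 : Tendsto (fun n => (w n).2) atTop (𝓝 a.2) := (continuous_snd.tendsto a).comp ha
    have ha1 : a.1 ∈ K := hcp.isClosed.mem_of_tendsto h1 (Eventually.of_forall fun n => (hw n).1)
    refine ⟨ha1, ?_⟩
    choose q hq hqle using fun n => hS (w n).1 (hw n).1 a.1 ha1 (w n).2 (hw n).2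
    have h3 : Tendsto (fun n => (w n).2 - q n) atTop (𝓝 0) :=
      squeeze_zero_norm hqle (tendsto_iff_norm_sub_tendsto_zero.mp h1)
    have h4 : Tendsto q atTop (𝓝 a.2) := by simpa using h2.sub h3
    exact (hScl _ ha1).mem_of_tendsto h4 (Eventually.of_forall hq)
  have hGcp : IsCompact G := (hcp.prod hcp).of_isClosed_subset hGcl hGsub
  have hGne : G.Nonempty := by
    obtain ⟨u, hu⟩ := hSne p₀ hp₀
    exact ⟨(p₀, u), hp₀, hu⟩
  obtain ⟨C, hC⟩ := hcp.isBounded.exists_norm_le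
  have approx : ∀ ε : ℝ, 0 < ε → ε < 1 → ∃ w ∈ G, ‖w.1 - w.2‖ ≤ ε * (2 * C) := by
    intro ε hε hε1
    obtain ⟨w, hw, hmin⟩ := hGcp.exists_isMinOn hGne
      (f := fun w : X × X => ‖w.1 - ((1 - ε) • w.2 + ε • p₀)‖) (by fun_prop)
    have hx' : (1 - ε) • w.2 + ε • p₀ ∈ K :=
      hconv (hGsub hw).2 hp₀ (by linarith) hε.le (by ring)
    obtain ⟨u, hu, hule⟩ := hS w.1 hw.1 _ hx' w.2 hw.2
    have hm := isMinOn_iff.mp hmin (_, u) ⟨hx', hu⟩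
    have he : (1 - ε) • w.2 + ε • p₀ - ((1 - ε) • u + ε • p₀) = (1 - ε) • (w.2 - u) := by
      module
    simp only [he, norm_smul, Real.norm_of_nonneg (by linarith : (0 : ℝ) ≤ 1 - ε)] at hm
    have h0 : ‖w.1 - ((1 - ε) • w.2 + ε • p₀)‖ = 0 := by
      nlinarith [norm_nonneg (w.1 - ((1 - ε) • w.2 + ε • p₀))]
    refine ⟨w, hw, ?_⟩
    have hw1 : w.1 - w.2 = ε • (p₀ - w.2) := by
      rw [sub_eq_zero.mp (norm_eq_zero.mp h0)]
      module
    rw [hw1, norm_smul, Real.norm_of_nonneg hε.le]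
    gcongr
    linarith [norm_sub_le p₀ w.2, hC _ hp₀, hC _ (hGsub hw).2]
  obtain ⟨w, hw, hmin⟩ := hGcp.exists_isMinOn hGne
    (f := fun w : X × X => ‖w.1 - w.2‖) (by fun_prop)
  have h0 : ‖w.1 - w.2‖ ≤ 0 := by
    have hlim : Tendsto (fun ε : ℝ => ε * (2 * C)) (𝓝[>] 0) (𝓝 0) := by
      have : Tendsto (fun ε : ℝ => ε * (2 * C)) (𝓝 0) (𝓝 (0 * (2 * C))) :=
        (continuous_id.mul continuous_const).tendsto 0
      rw [zero_mul] at this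
      exact this.mono_left nhdsWithin_le_nhds
    refine ge_of_tendsto hlim ?_
    filter_upwards [Ioo_mem_nhdsGT (zero_lt_one' ℝ)] with ε hε
    obtain ⟨v, hv, hvle⟩ := approx ε hε.1 hε.2
    exact (isMinOn_iff.mp hmin v hv).trans hvle
  refine ⟨w.1, hw.1, ?_⟩
  have hw12 : w.1 = w.2 := sub_eq_zero.mp (norm_le_zero_iff.mp h0)
  have := hw.2
  rwa [← hw12] at this

/-- In a strictly convex space the fixed points of a nonexpansive self-map of a convex set form a
convex set. -/
theorem convex_fixedPoints_of_nonexpansive {X : Type*}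
    [NormedAddCommGroup X] [NormedSpace ℝ X] [StrictConvexSpace ℝ X] {D : Set X}
    (hconv : Convex ℝ D) {t : X → X}
    (htnonexp : ∀ x ∈ D, ∀ y ∈ D, ‖t x - t y‖ ≤ ‖x - y‖) :
    Convex ℝ {x | x ∈ D ∧ t x = x} := by
  rintro p ⟨hp, htp⟩ q ⟨hq, htq⟩ a b ha hb hab
  have hz := hconv hp hq ha hb hab
  refine ⟨hz, ?_⟩
  obtain rfl : a = 1 - b := by linarith
  have h1 := htnonexp p hp _ hz
  have h2 := htnonexp _ hz q hq
  rw [htp] at h1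
  rw [htq] at h2
  have e1 : p - ((1 - b) • p + b • q) = b • (p - q) := by module
  have e2 : (1 - b) • p + b • q - q = (1 - b) • (p - q) := by module
  rw [e1, norm_smul, Real.norm_of_nonneg hb] at h1
  rw [e2, norm_smul, Real.norm_of_nonneg ha] at h2
  have h3 := norm_sub_le_norm_sub_add_norm_sub p (t ((1 - b) • p + b • q)) q
  have h4 : t ((1 - b) • p + b • q) = AffineMap.lineMap p q b := by
    apply eq_lineMap_of_dist_eq_mul_of_dist_eq_mul <;> rw [dist_eq_norm, dist_eq_norm] <;> linarith
  rw [h4, AffineMap.lineMap_apply_module]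

open Filter Topology in
/-- Edelstein's theorem: in a strictly convex space, the averaged iterates of a nonexpansive
self-map of a compact convex set converge to a fixed point. -/
theorem exists_tendsto_iterate_average {X : Type*}
    [NormedAddCommGroup X] [NormedSpace ℝ X] [StrictConvexSpace ℝ X] {D : Set X}
    (hcp : IsCompact D) {t s : X → X}
    (htnonexp : ∀ x ∈ D, ∀ y ∈ D, ‖t x - t y‖ ≤ ‖x - y‖)
    (hs : ∀ x, s x = (1 / 2 : ℝ) • x + (1 / 2 : ℝ) • t x) (hsD : Set.MapsTo s D D)
    (hsnonexp : ∀ x ∈ D, ∀ y ∈ D, ‖s x - s y‖ ≤ ‖x - y‖)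
    {p : X} (hp : p ∈ D) (htp : t p = p) {x : X} (hx : x ∈ D) :
    ∃ q ∈ D, t q = q ∧ Tendsto (fun n => s^[n] x) atTop (𝓝 q) := by
  have hfix : ∀ z, t z = z → s z = z := fun z hz => by
    rw [hs, hz]
    module
  have hmem : ∀ n, s^[n] x ∈ D := fun n => hsD.iterate n hx
  have hanti : ∀ z ∈ D, t z = z → Antitone fun n => ‖s^[n] x - z‖ := fun z hz htz => by
    refine antitone_nat_of_succ_le fun n => ?_
    have := hsnonexp _ (hmem n) z hz
    rwa [hfix z htz, ← Function.iterate_succ_apply' s] at this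
  have hlim : ∀ z ∈ D, t z = z →
      Tendsto (fun n => ‖s^[n] x - z‖) atTop (𝓝 (⨅ n, ‖s^[n] x - z‖)) := fun z hz htz =>
    tendsto_atTop_ciInf (hanti z hz htz) ⟨0, by rintro _ ⟨n, rfl⟩; exact norm_nonneg _⟩
  obtain ⟨q, hq, φ, hφ, hφq⟩ := hcp.tendsto_subseq hmem
  have hscont : ContinuousOn s D := by
    refine (LipschitzOnWith.of_dist_le_mul (K := 1) fun a ha b hb => ?_).continuousOn
    simpa [dist_eq_norm] using hsnonexp a ha b hb
  have hsq : Tendsto (fun n => s (s^[φ n] x)) atTop (𝓝 (s q)) :=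
    (hscont q hq).tendsto.comp
      (tendsto_nhdsWithin_iff.mpr ⟨hφq, Eventually.of_forall fun n => hmem _⟩)
  have heq : ‖s q - p‖ = ‖q - p‖ := by
    have h1 := tendsto_nhds_unique ((hφq.sub_const p).norm)
      ((hlim p hp htp).comp hφ.tendsto_atTop)
    have h2 := ((tendsto_add_atTop_iff_nat 1).mpr (hlim p hp htp)).comp hφ.tendsto_atTop
    simp only [Function.comp_def, Function.iterate_succ_apply'] at h2
    rw [h1]
    exact tendsto_nhds_unique (hsq.sub_const p).norm h2
  have hle := htnonexp q hq p hp
  rw [htp] at hle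
  have hsum : ‖(q - p) + (t q - p)‖ = 2 * ‖q - p‖ := by
    have : (q - p) + (t q - p) = (2 : ℝ) • (s q - p) := by
      rw [hs]
      module
    rw [this, norm_smul, heq]
    norm_num
  have hnorm : ‖q - p‖ = ‖t q - p‖ := by
    linarith [norm_add_le (q - p) (t q - p)]
  have htq : t q = q := by
    have := eq_of_norm_eq_of_norm_add_eq hnorm (by linarith)
    exact (sub_left_inj.mp this).symm
  refine ⟨q, hq, htq, tendsto_iff_norm_sub_tendsto_zero.mpr ?_⟩
  have h1 := tendsto_nhds_unique (tendsto_iff_norm_sub_tendsto_zero.mp hφq)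
    ((hlim q hq htq).comp hφ.tendsto_atTop)
  rw [h1]
  exact hlim q hq htq

open Filter Topology in
/-- In a strictly convex space, the fixed point set of a nonexpansive self-map `t` of a compact
convex set is a nonexpansive retract, by a retraction that leaves invariant every closed convex
`t`-invariant subset. -/
theorem exists_nonexpansive_retraction_fixedPoints {X : Type*}
    [NormedAddCommGroup X] [NormedSpace ℝ X] [StrictConvexSpace ℝ X] {D : Set X}
    (hcp : IsCompact D) (hconv : Convex ℝ D) {t : X → X} (ht : Set.MapsTo t D D)
    (htnonexp : ∀ x ∈ D, ∀ y ∈ D, ‖t x - t y‖ ≤ ‖x - y‖) {p : X} (hp : p ∈ D) (htp : t p = p) :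
    ∃ R : X → X, (∀ x ∈ D, R x ∈ D ∧ t (R x) = R x) ∧ (∀ x ∈ D, t x = x → R x = x) ∧
      (∀ x ∈ D, ∀ y ∈ D, ‖R x - R y‖ ≤ ‖x - y‖) ∧
      ∀ E ⊆ D, IsClosed E → Convex ℝ E → Set.MapsTo t E E → Set.MapsTo R E E := by
  set s : X → X := fun x => (1 / 2 : ℝ) • x + (1 / 2 : ℝ) • t x with hs
  have hsE : ∀ E : Set X, Convex ℝ E → Set.MapsTo t E E → Set.MapsTo s E E :=
    fun E hE htE x hx => hE hx (htE hx) (by norm_num) (by norm_num) (by norm_num)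
  have hsD := hsE D hconv ht
  have hsnonexp : ∀ x ∈ D, ∀ y ∈ D, ‖s x - s y‖ ≤ ‖x - y‖ := fun x hx y hy => by
    have e : s x - s y = (1 / 2 : ℝ) • (x - y) + (1 / 2 : ℝ) • (t x - t y) := by
      simp only [hs]
      module
    have h := norm_add_le ((1 / 2 : ℝ) • (x - y)) ((1 / 2 : ℝ) • (t x - t y))
    rw [← e, norm_smul, norm_smul, Real.norm_of_nonneg (by norm_num)] at h
    linarith [htnonexp x hx y hy]
  choose! R hRD hRt hR using fun x (hx : x ∈ D) =>
    exists_tendsto_iterate_average hcp htnonexp (fun _ => rfl) hsD hsnonexp hp htp hx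
  refine ⟨R, fun x hx => ⟨hRD x hx, hRt x hx⟩, fun x hx htx => ?_, fun x hx y hy => ?_,
    fun E hED hEcl hE htE x hx => ?_⟩
  · have hsx : s x = x := by
      simp only [hs, htx]
      module
    exact tendsto_nhds_unique ((hR x hx).congr fun n => Function.iterate_fixed hsx n)
      tendsto_const_nhds
  · refine le_of_tendsto ((hR x hx).sub (hR y hy)).norm (Eventually.of_forall fun n => ?_)
    induction n with
    | zero => simp
    | succ n ih =>
      rw [Function.iterate_succ_apply', Function.iterate_succ_apply']
      exact (hsnonexp _ (hsD.iterate n hx) _ (hsD.iterate n hy)).trans ih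
  · exact hEcl.mem_of_tendsto (hR x (hED hx))
      (Eventually.of_forall fun n => (hsE E hE htE).iterate n hx)


/-- Corollary 3.12: Let `D` be a nonempty compact convex subset of a
strictly convex Banach space, `t : D → D` a nonexpansive single-valued mapping and
`T : D → KC(D)` a nonexpansive multivalued mapping, which commute. Then there exists
`z ∈ D` with `z = t(z) ∈ T(z)`. -/
theorem common_fixed_point_nonexpansive_compact {X : Type*}
    [NormedAddCommGroup X] [NormedSpace ℝ X] [CompleteSpace X] [StrictConvexSpace ℝ X]
    (D : Set X) (hne : D.Nonempty) (hcp : IsCompact D) (hconv : Convex ℝ D)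
    (t : X → X) (ht : Set.MapsTo t D D)
    (htnonexp : ∀ x ∈ D, ∀ y ∈ D, ‖t x - t y‖ ≤ ‖x - y‖)
    (T : X → Set X)
    (hTne : ∀ x ∈ D, (T x).Nonempty) (hTcp : ∀ x ∈ D, IsCompact (T x))
    (hTconv : ∀ x ∈ D, Convex ℝ (T x)) (hTsub : ∀ x ∈ D, T x ⊆ D)
    (hTnonexp : ∀ x ∈ D, ∀ y ∈ D, Metric.hausdorffDist (T x) (T y) ≤ ‖x - y‖)
    (hcomm : ∀ x ∈ D, ∀ y ∈ D, x ∈ T y → t y ∈ D → t x ∈ T (t y)) :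
    ∃ z ∈ D, t z = z ∧ z ∈ T z := by
  have hTsel : ∀ x ∈ D, ∀ y ∈ D, ∀ p ∈ T x, ∃ q ∈ T y, ‖p - q‖ ≤ ‖x - y‖ := by
    intro x hx y hy p hp
    obtain ⟨q, hq, hpq⟩ := (hTcp y hy).exists_infDist_eq_dist (hTne y hy) p
    refine ⟨q, hq, ?_⟩
    rw [← dist_eq_norm, ← hpq]
    exact (Metric.infDist_le_hausdorffDist_of_mem hp
      (Metric.hausdorffEDist_ne_top_of_nonempty_of_bounded (hTne x hx) (hTne y hy)
        (hTcp x hx).isBounded (hTcp y hy).isBounded)).trans (hTnonexp x hx y hy)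
  obtain ⟨p, hp, hpt⟩ := exists_mem_self_of_nonexpansive_setValued hne hcp hconv (fun x => {t x})
    (fun x _ => Set.singleton_nonempty _) (fun x _ => isClosed_singleton)
    (fun x hx => Set.singleton_subset_iff.mpr (ht hx))
    (fun x hx y hy _ h => ⟨t y, rfl, by rw [Set.mem_singleton_iff.mp h]; exact htnonexp x hx y hy⟩)
  have htp : t p = p := (Set.mem_singleton_iff.mp hpt).symm
  obtain ⟨R, hRF, hRfix, hRnonexp, hRinv⟩ :=
    exists_nonexpansive_retraction_fixedPoints hcp hconv ht htnonexp hp htp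
  have htcont : ContinuousOn t D := by
    refine (LipschitzOnWith.of_dist_le_mul (K := 1) fun a ha b hb => ?_).continuousOn
    simpa [dist_eq_norm] using htnonexp a ha b hb
  set F : Set X := {x | x ∈ D ∧ t x = x} with hF
  have hFcl : IsClosed F := by
    refine isSeqClosed_iff_isClosed.mp fun w a hw ha => ?_
    have haD : a ∈ D :=
      hcp.isClosed.mem_of_tendsto ha (Filter.Eventually.of_forall fun n => (hw n).1)
    refine ⟨haD, tendsto_nhds_unique ?_ ha⟩
    have h := (htcont a haD).tendsto.comp
      (tendsto_nhdsWithin_iff.mpr ⟨ha, Filter.Eventually.of_forall fun n => (hw n).1⟩)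
    exact h.congr fun n => (hw n).2
  have hRT : ∀ y ∈ F, ∀ q ∈ T y, R q ∈ T y ∩ F := fun y hy q hq =>
    ⟨hRinv (T y) (hTsub y hy.1) (hTcp y hy.1).isClosed (hTconv y hy.1)
      (fun u hu => by
        have := hcomm u (hTsub y hy.1 hu) y hy.1 hu (ht hy.1)
        rwa [hy.2] at this) hq, hRF q (hTsub y hy.1 hq)⟩
  obtain ⟨z, hz, hzT⟩ := exists_mem_self_of_nonexpansive_setValued (K := F) ⟨p, hp, htp⟩
    (hcp.of_isClosed_subset hFcl fun x hx => hx.1)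
    (convex_fixedPoints_of_nonexpansive hconv htnonexp) (fun y => T y ∩ F)
    (fun y hy => (hTne y hy.1).elim fun q hq => ⟨R q, hRT y hy q hq⟩)
    (fun y hy => (hTcp y hy.1).isClosed.inter hFcl) (fun y _ => Set.inter_subset_right)
    (fun x hx y hy u hu => by
      obtain ⟨q, hq, hqle⟩ := hTsel x hx.1 y hy.1 u hu.1
      refine ⟨R q, hRT y hy q hq, ?_⟩
      have h := hRnonexp u hu.2.1 q (hTsub y hy.1 hq)
      rw [hRfix u hu.2.1 hu.2.2] at h
      exact h.trans hqle)
  exact ⟨z, hz.1, hz.2, hzT.1⟩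
end
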